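/- For every dimension m ≥ 1, every τ > 0, and every nonnegative smooth compactly supported function φ on ℝ^m with ∫_{ℝ^m} φ² dx = 1, one has 4τ ∫_{ℝ^m} |∇φ|² dx - 2 ∫_{ℝ^m} φ² log φ dx ≥ m + (m/2) log(4πτ). Equivalently, the localized entropy of Euclidean space satisfies μ^{(0)}(ℝ^m, g_E, τ) ≥ 0 for all τ > 0. -/

import Mathlib

open MeasureTheory Real Set

/-- The localized Perelman `W`-functional on a domain `Ω` of the Euclidean
`m`-dimensional space, with potential function `a`, test function `φ` and scale `τ`. -/
noncomputable def Wfun (m : ℕ) (Ω : Set (EuclideanSpace ℝ (Fin m)))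
    (a φ : EuclideanSpace ℝ (Fin m) → ℝ) (τ : ℝ) : ℝ :=
  -(m : ℝ) - ((m : ℝ) / 2) * Real.log (4 * Real.pi * τ) +
    ∫ x in Ω, (τ * (a x * (φ x) ^ 2 + 4 * ‖fderiv ℝ φ x‖ ^ 2)
      - 2 * (φ x) ^ 2 * Real.log (φ x))

/-- Admissible test functions: smooth, nonnegative, compactly supported in `Ω`,
with `∫ φ² = 1`. -/
def Admissible (m : ℕ) (Ω : Set (EuclideanSpace ℝ (Fin m)))
    (φ : EuclideanSpace ℝ (Fin m) → ℝ) : Prop :=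
  ContDiff ℝ (⊤ : ℕ∞) φ ∧ HasCompactSupport φ ∧ tsupport φ ⊆ Ω ∧ (∀ x, 0 ≤ φ x) ∧
    (∫ x in Ω, (φ x) ^ 2) = 1

/-- The localized Perelman `μ`-functional: infimum of the `W`-functional over
admissible test functions. -/
noncomputable def muFun (m : ℕ) (Ω : Set (EuclideanSpace ℝ (Fin m)))
    (a : EuclideanSpace ℝ (Fin m) → ℝ) (τ : ℝ) : ℝ :=
  sInf { w : ℝ | ∃ φ, Admissible m Ω φ ∧ w = Wfun m Ω a φ τ }

open ProbabilityTheory Filter Topology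
open scoped NNReal

lemma hasDerivAt_int_Iic {q : ℝ → ℝ} (hc : Continuous q) (hi : Integrable q) (x : ℝ) :
    HasDerivAt (fun x => ∫ t in Iic x, q t) (q x) x := by
  have h1 : (fun x => ∫ t in Iic x, q t) = fun x => (∫ t in Iic 0, q t) + ∫ t in (0:ℝ)..x, q t := by
    funext x
    have := intervalIntegral.integral_Iic_sub_Iic (μ := volume) (f := q) (a := 0) (b := x)
      hi.integrableOn hi.integrableOn
    linarith
  rw [h1]
  exact (intervalIntegral.integral_hasDerivAt_right (hc.intervalIntegrable _ _)
    (hc.stronglyMeasurableAtFilter _ _) hc.continuousAt).const_add _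

lemma continuous_gp (v : ℝ≥0) : Continuous (gaussianPDFReal 0 v) := by
  unfold gaussianPDFReal; fun_prop

lemma hasDerivAt_gp (v : ℝ≥0) (x : ℝ) :
    HasDerivAt (gaussianPDFReal 0 v) (-(x / v) * gaussianPDFReal 0 v x) x := by
  have h : HasDerivAt (fun x : ℝ => (√(2 * π * v))⁻¹ * rexp (-(x - 0) ^ 2 / (2 * v)))
    ((√(2 * π * v))⁻¹ * (rexp (-(x - 0) ^ 2 / (2 * v)) * (-(2 * (x - 0)) / (2 * v)))) x := by
    refine (HasDerivAt.exp ?_).const_mul _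
    refine HasDerivAt.div_const ?_ _
    refine ((((hasDerivAt_id x).sub_const 0).pow 2).neg).congr_deriv ?_
    simp
  refine HasDerivAt.congr_deriv (f := gaussianPDFReal 0 v) h ?_
  simp only [gaussianPDFReal]
  rw [show -(2 * (x - 0)) / (2 * (v:ℝ)) = -(x / v) by
    rw [sub_zero, neg_div, mul_div_mul_left _ _ two_ne_zero]]
  ring

/-- The distribution function of the Gaussian. -/
noncomputable def gPhi (v : ℝ≥0) (x : ℝ) : ℝ := ∫ t in Iic x, gaussianPDFReal 0 v t

lemma hasDerivAt_gPhi (v : ℝ≥0) (x : ℝ) : HasDerivAt (gPhi v) (gaussianPDFReal 0 v x) x :=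
  hasDerivAt_int_Iic (continuous_gp v) (integrable_gaussianPDFReal 0 v) x

lemma gPhi_strictMono {v : ℝ≥0} (hv : v ≠ 0) : StrictMono (gPhi v) := by
  apply strictMono_of_deriv_pos
  intro x
  rw [(hasDerivAt_gPhi v x).deriv]
  exact gaussianPDFReal_pos 0 v x hv

lemma gPhi_cont (v : ℝ≥0) : Continuous (gPhi v) :=
  continuous_iff_continuousAt.2 fun x => (hasDerivAt_gPhi v x).continuousAt

lemma gPhi_eq_cdf {v : ℝ≥0} (hv : v ≠ 0) (x : ℝ) : gPhi v x = cdf (gaussianReal 0 v) x := by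
  rw [cdf_eq_real, Measure.real, gaussianReal_apply_eq_integral 0 hv, ENNReal.toReal_ofReal]
  · rfl
  · exact integral_nonneg fun x => gaussianPDFReal_nonneg _ _ _

lemma gPhi_surj {v : ℝ≥0} (hv : v ≠ 0) {y : ℝ} (h0 : 0 < y) (h1 : y < 1) : ∃ x, gPhi v x = y := by
  have hb : Tendsto (gPhi v) atBot (𝓝 0) := by
    rw [show gPhi v = cdf (gaussianReal 0 v) from funext (gPhi_eq_cdf hv)]
    exact tendsto_cdf_atBot _
  have ht : Tendsto (gPhi v) atTop (𝓝 1) := by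
    rw [show gPhi v = cdf (gaussianReal 0 v) from funext (gPhi_eq_cdf hv)]
    exact tendsto_cdf_atTop _
  obtain ⟨a, ha⟩ := (hb.eventually (gt_mem_nhds h0)).exists
  obtain ⟨b, hb'⟩ := (ht.eventually (lt_mem_nhds h1)).exists
  exact mem_range_of_exists_le_of_exists_ge (gPhi_cont v) ⟨a, ha.le⟩ ⟨b, hb'.le⟩

/-- monotone transport map -/
lemma exists_transport {v : ℝ≥0} (hv : v ≠ 0) {G q : ℝ → ℝ} {δ : ℝ} (hδ : 0 < δ) (hδ1 : δ < 1)
    (hG : ∀ x, HasDerivAt G (q x) x) (hl : ∀ x, δ ≤ G x) (hu : ∀ x, G x ≤ 1 - δ) :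
    ∃ T : ℝ → ℝ, ∃ B, (∀ x, |T x| ≤ B) ∧
      ∀ x, HasDerivAt T (q x / gaussianPDFReal 0 v (T x)) x := by
  choose T hT using fun x => gPhi_surj hv (lt_of_lt_of_le hδ (hl x))
    (lt_of_le_of_lt (hu x) (by linarith))
  have hm := gPhi_strictMono hv
  have hord : OrdConnected (range (gPhi v)) := (isPreconnected_range (gPhi_cont v)).ordConnected
  have hemb := hm.isEmbedding_of_ordConnected hord
  have hTc : Continuous T := by
    rw [hemb.continuous_iff]
    have : gPhi v ∘ T = G := funext hT
    rw [this]
    exact continuous_iff_continuousAt.2 fun x => (hG x).continuousAt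
  obtain ⟨a, ha⟩ := gPhi_surj hv hδ hδ1
  obtain ⟨b, hb⟩ := gPhi_surj hv (y := 1 - δ) (by linarith) (by linarith)
  refine ⟨T, max |a| |b|, fun x => ?_, fun x => ?_⟩
  · apply abs_le_max_abs_abs
    · rw [← hm.le_iff_le, ha, hT]; exact hl x
    · rw [← hm.le_iff_le, hb, hT]; exact hu x
  · have hp := gaussianPDFReal_pos 0 v (T x) hv
    have hop : IsOpenEmbedding (gPhi v) := by
      refine ⟨hemb, ?_⟩
      have : range (gPhi v) = Ioo 0 1 := by
        ext y
        constructor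
        · rintro ⟨z, rfl⟩
          constructor
          · refine lt_of_le_of_lt ?_ (hm (sub_one_lt z))
            rw [gPhi_eq_cdf hv]; exact cdf_nonneg _ _
          · refine lt_of_lt_of_le (hm (lt_add_one z)) ?_
            rw [gPhi_eq_cdf hv]; exact cdf_le_one _ _
        · rintro ⟨h0, h1⟩
          exact gPhi_surj hv h0 h1
      rw [this]; exact isOpen_Ioo
    let e := hop.toOpenPartialHomeomorph (gPhi v)
    have hmem : G x ∈ e.target := by
      simp only [e, IsOpenEmbedding.toOpenPartialHomeomorph_target]
      exact ⟨T x, hT x⟩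
    have hes : ∀ y, e.symm (G y) = T y := by
      intro y
      rw [← hT y]
      exact e.left_inv (by simp [e])
    have h2 : HasDerivAt e.symm (gaussianPDFReal 0 v (T x))⁻¹ (G x) := by
      refine e.hasDerivAt_symm hmem hp.ne' ?_
      rw [hes]
      exact hasDerivAt_gPhi v (T x)
    have h3 := h2.comp x (hG x)
    have h4 : e.symm ∘ G = T := funext hes
    rw [h4] at h3
    refine h3.congr_deriv ?_
    rw [div_eq_mul_inv, mul_comm]

lemma integrable_gp_poly {v : ℝ≥0} (hv : v ≠ 0) :
    Integrable (fun x : ℝ => (1 + x ^ 2) * gaussianPDFReal 0 v x) := by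
  have h1 := integrable_gaussianPDFReal 0 v
  have hv' : (0:ℝ) < v := by positivity
  have h2 : Integrable (fun x : ℝ => x ^ 2 * gaussianPDFReal 0 v x) := by
    have h := (integrable_rpow_mul_exp_neg_mul_sq (b := 1 / (2 * (v:ℝ))) (by positivity)
      (s := 2) (by norm_num)).const_mul ((√(2 * π * v))⁻¹)
    refine h.congr (Eventually.of_forall fun x => ?_)
    simp only [gaussianPDFReal, sub_zero]
    rw [show x ^ (2:ℝ) = x ^ 2 from Real.rpow_natCast x 2,
      show -(1 / (2 * (v:ℝ))) * x ^ 2 = -x ^ 2 / (2 * v) by ring]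
    ring
  refine (h1.add h2).congr (Eventually.of_forall fun x => ?_)
  simp only [Pi.add_apply]; ring

lemma integrable_of_poly {v : ℝ≥0} (hv : v ≠ 0) {h : ℝ → ℝ} (hc : Continuous h) (K : ℝ)
    (hK : ∀ x, |h x| ≤ K * ((1 + x ^ 2) * gaussianPDFReal 0 v x)) : Integrable h :=
  ((integrable_gp_poly hv).const_mul K).mono' hc.aestronglyMeasurable (Eventually.of_forall hK)

lemma gp_log {v : ℝ≥0} (hv : v ≠ 0) (x : ℝ) :
    Real.log (gaussianPDFReal 0 v x) = -(1 / 2) * Real.log (2 * π * v) - x ^ 2 / (2 * v) := by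
  have hv' : (0:ℝ) < v := by positivity
  simp only [gaussianPDFReal, sub_zero]
  rw [Real.log_mul (by positivity) (by positivity), Real.log_exp, Real.log_inv,
    Real.log_sqrt (by positivity)]
  ring

lemma gp_le {v : ℝ≥0} (x : ℝ) : gaussianPDFReal 0 v x ≤ gaussianPDFReal 0 v 0 := by
  simp only [gaussianPDFReal, sub_zero]
  have : (0:ℝ) ^ 2 ≤ x ^ 2 := by nlinarith [sq_nonneg x]
  apply mul_le_mul_of_nonneg_left _ (by positivity)
  apply Real.exp_le_exp.2
  apply div_le_div_of_nonneg_right _ (by positivity)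
  linarith

lemma gp_anti {v : ℝ≥0} {x B : ℝ} (h : |x| ≤ B) :
    gaussianPDFReal 0 v B ≤ gaussianPDFReal 0 v x := by
  simp only [gaussianPDFReal, sub_zero]
  have : x ^ 2 ≤ B ^ 2 := sq_le_sq' (by linarith [neg_abs_le x]) (le_trans (le_abs_self x) h)
  gcongr

/-- One dimensional inequality with defect. -/
lemma lsi_one_defect {v : ℝ≥0} (hv : v ≠ 0) {f f' : ℝ → ℝ} (hf : ∀ x, HasDerivAt f (f' x) x)
    (hf'c : Continuous f') {c C : ℝ} (hc : 0 < c) (hcf : ∀ x, c ≤ f x) (hfC : ∀ x, f x ≤ C)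
    (hf'C : ∀ x, |f' x| ≤ C) {δ : ℝ} (hδ : 0 < δ) (hδ1 : δ < 1 / 2) :
    ∫ x, gaussianPDFReal 0 v x * (f x * Real.log (f x)) ≤
      (∫ x, gaussianPDFReal 0 v x * (v / 2 * (f' x ^ 2 / f x))) +
      (∫ x, gaussianPDFReal 0 v x * f x) *
        (Real.log (∫ x, gaussianPDFReal 0 v x * f x) - Real.log (1 - 2 * δ)) := by
  have hv' : (0:ℝ) < v := by positivity
  set p := gaussianPDFReal 0 v with hp
  have hpc : Continuous p := continuous_gp v
  have hp0 : ∀ x, 0 < p x := fun x => gaussianPDFReal_pos 0 v x hv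
  have hfc : Continuous f := continuous_iff_continuousAt.2 fun x => (hf x).continuousAt
  have hf0 : ∀ x, 0 < f x := fun x => lt_of_lt_of_le hc (hcf x)
  have hC : 0 < C := lt_of_lt_of_le (hf0 0) (hfC 0)
  have hbd : ∀ {h : ℝ → ℝ}, Continuous h → ∀ K, (∀ x, |h x| ≤ K) →
      Integrable (fun x => p x * h x) := by
    intro h hh K hK
    refine integrable_of_poly hv (by fun_prop) K fun x => ?_
    have hK0 : 0 ≤ K := (abs_nonneg _).trans (hK 0)
    rw [abs_mul, abs_of_pos (hp0 x)]
    calc p x * |h x| ≤ p x * K := by gcongr; exacts [(hp0 x).le, hK x]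
      _ = K * (1 * p x) := by ring
      _ ≤ K * ((1 + x ^ 2) * p x) := by
        gcongr
        · exact (hp0 x).le
        · nlinarith [sq_nonneg x]
  have hfi : Integrable (fun x => p x * f x) :=
    hbd hfc C fun x => by rw [abs_of_pos (hf0 x)]; exact hfC x
  set M := ∫ x, p x * f x with hM
  have hM0 : 0 < M := by
    rw [hM, integral_pos_iff_support_of_nonneg (fun x => (mul_pos (hp0 x) (hf0 x)).le) hfi]
    have : Function.support (fun x => p x * f x) = univ := by
      ext x; simp [(hp0 x).ne', (hf0 x).ne']
    rw [this]; simp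
  have h2δ : 0 < 1 - 2 * δ := by linarith
  set k := (1 - 2 * δ) / M with hk
  have hk0 : 0 < k := by positivity
  have hGd : ∀ x, HasDerivAt (fun x => δ + k * ∫ t in Iic x, p t * f t) (k * (p x * f x)) x :=
    fun x => ((hasDerivAt_int_Iic (by fun_prop) hfi x).const_mul k).const_add δ
  have hnn : ∀ x, 0 ≤ p x * f x := fun x => (mul_pos (hp0 x) (hf0 x)).le
  obtain ⟨T, B, hTB, hT⟩ := exists_transport hv (δ := δ) hδ (by linarith) hGd
    (fun x => by
      have : 0 ≤ ∫ t in Iic x, p t * f t := integral_nonneg hnn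
      have := mul_nonneg hk0.le this
      linarith)
    (fun x => by
      have : ∫ t in Iic x, p t * f t ≤ M :=
        setIntegral_le_integral hfi (Eventually.of_forall hnn)
      have := mul_le_mul_of_nonneg_left this hk0.le
      have h3 : k * M = 1 - 2 * δ := by rw [hk]; field_simp
      linarith)
  have hTc : Continuous T := continuous_iff_continuousAt.2 fun x => (hT x).continuousAt
  set S : ℝ → ℝ := fun x => k * (p x * f x) / p (T x) with hS
  have hSc : Continuous S := by
    refine Continuous.div (by fun_prop) (by fun_prop) fun x => (hp0 _).ne'
  have hS0 : ∀ x, 0 < S x := fun x =>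
    div_pos (mul_pos hk0 (mul_pos (hp0 x) (hf0 x))) (hp0 _)
  have hB0 : 0 ≤ B := (abs_nonneg _).trans (hTB 0)
  obtain ⟨A, hA⟩ : ∃ A, ∀ x, S x ≤ A := by
    refine ⟨k * (p 0 * C) / p B, fun x => ?_⟩
    have h1 := gp_le (v := v) x
    have h2 := gp_anti (v := v) (hTB x)
    have h3 := hfC x
    have := hp0 0
    have := hp0 B
    have := (hf0 x).le
    simp only [hS]
    gcongr
  have hA0 : 0 < A := (hS0 0).trans_le (hA 0)
  set u : ℝ → ℝ := fun x => T x - x with hu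
  have huc : Continuous u := by fun_prop
  have hub : ∀ x, |u x| ≤ B + |x| := fun x => (abs_sub _ _).trans (by gcongr; exact hTB x)
  have hHd : ∀ x, HasDerivAt (fun x => p x * (f x * u x))
      (p x * (f' x * u x - x * f x * u x / v + f x * (S x - 1))) x := by
    intro x
    refine ((hasDerivAt_gp v x).mul ((hf x).mul ((hT x).sub (hasDerivAt_id x)))).congr_deriv ?_
    simp only [hS, hu, ← hp, Pi.mul_apply, Pi.sub_apply, id]
    ring
  have hx1 : ∀ x : ℝ, |x| ≤ 1 + x ^ 2 := fun x => by
    rw [← sq_abs]; nlinarith [sq_nonneg (|x| - 1), abs_nonneg x]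
  have hx2 : ∀ x : ℝ, (1:ℝ) ≤ 1 + x ^ 2 := fun x => by nlinarith [sq_nonneg x]
  have hub2 : ∀ x, |u x| ≤ (B + 1) * (1 + x ^ 2) := fun x => by
    have := hub x
    have := hx1 x
    have := hx2 x
    nlinarith
  have hxu : ∀ x, |x| * |u x| ≤ (B + 1) * (1 + x ^ 2) := fun x => by
    have h1 := mul_le_mul_of_nonneg_left (hub x) (abs_nonneg x)
    have h2 := mul_le_mul_of_nonneg_right (hx1 x) hB0
    have h3 : |x| * |x| = x ^ 2 := by rw [← sq, sq_abs]
    nlinarith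
  have hHi : Integrable (fun x => p x * (f x * u x)) := by
    refine integrable_of_poly hv (by fun_prop) (C * (B + 1)) fun x => ?_
    rw [abs_mul, abs_mul, abs_of_pos (hp0 x), abs_of_pos (hf0 x)]
    have := hub2 x
    have := hfC x
    have := (hf0 x).le
    have := (hp0 x).le
    calc p x * (f x * |u x|) ≤ p x * (C * ((B + 1) * (1 + x ^ 2))) := by gcongr
      _ = _ := by ring
  have hH'i : Integrable (fun x => p x * (f' x * u x - x * f x * u x / v + f x * (S x - 1))) := by
    refine integrable_of_poly hv (by fun_prop)
      (C * (B + 1) + C * (B + 1) / v + C * (A + 1)) fun x => ?_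
    rw [abs_mul, abs_of_pos (hp0 x)]
    have h1 : |f' x * u x| ≤ C * ((B + 1) * (1 + x ^ 2)) := by
      rw [abs_mul]
      have := hub2 x
      have := hf'C x
      gcongr
    have h2 : |x * f x * u x / v| ≤ C * ((B + 1) * (1 + x ^ 2)) / v := by
      rw [abs_div, abs_mul, abs_mul, abs_of_pos (hf0 x), abs_of_pos hv']
      have := hxu x
      have := hfC x
      have := (hf0 x).le
      calc |x| * f x * |u x| / v = f x * (|x| * |u x|) / v := by ring
        _ ≤ _ := by gcongr
    have h3 : |f x * (S x - 1)| ≤ C * ((A + 1) * (1 + x ^ 2)) := by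
      rw [abs_mul, abs_of_pos (hf0 x)]
      have h4 : |S x - 1| ≤ (A + 1) * (1 + x ^ 2) := by
        have h5 : |S x - 1| ≤ A + 1 := by
          rw [abs_le]; constructor <;> linarith [hS0 x, hA x]
        nlinarith [hx2 x]
      have := hfC x
      gcongr
    have h4 : |f' x * u x - x * f x * u x / v + f x * (S x - 1)| ≤
        C * ((B + 1) * (1 + x ^ 2)) + C * ((B + 1) * (1 + x ^ 2)) / v +
          C * ((A + 1) * (1 + x ^ 2)) :=
      (abs_add_le _ _).trans (add_le_add ((abs_sub _ _).trans (add_le_add h1 h2)) h3)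
    calc _ ≤ p x * _ := mul_le_mul_of_nonneg_left h4 (hp0 x).le
      _ = _ := by ring
  have hzero := integral_eq_zero_of_hasDerivAt_of_integrable hHd hH'i hHi
  have hlogi : Integrable (fun x => p x * (f x * Real.log (f x))) := by
    refine hbd (by fun_prop (disch := exact fun x => (hf0 x).ne')) (C * (|Real.log c| + |Real.log C|)) fun x => ?_
    rw [abs_mul, abs_of_pos (hf0 x)]
    have h1 : |Real.log (f x)| ≤ |Real.log c| + |Real.log C| :=
      (abs_le_max_abs_abs (Real.log_le_log hc (hcf x)) (Real.log_le_log (hf0 x) (hfC x))).trans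
        (max_le_add_of_nonneg (abs_nonneg _) (abs_nonneg _))
    have := hfC x
    gcongr
  have hIi : Integrable (fun x => p x * (v / 2 * (f' x ^ 2 / f x))) := by
    refine hbd (by fun_prop (disch := exact fun x => (hf0 x).ne')) (v / 2 * (C ^ 2 / c)) fun x => ?_
    rw [abs_of_nonneg (by have := hf0 x; positivity), ← sq_abs]
    have := hf'C x
    have := hcf x
    gcongr
  have hpt : ∀ x, p x * (f x * Real.log (f x)) ≤
      p x * (f' x * u x - x * f x * u x / v + f x * (S x - 1)) +
      p x * (v / 2 * (f' x ^ 2 / f x)) + p x * f x * (Real.log M - Real.log (1 - 2 * δ)) := by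
    intro x
    have hl : Real.log (S x) = Real.log (1 - 2 * δ) - Real.log M + (Real.log (p x)
        + Real.log (f x)) - Real.log (p (T x)) := by
      simp only [hS, hk]
      rw [Real.log_div (by have := hp0 x; have := hf0 x; positivity) (hp0 _).ne',
        Real.log_mul (by positivity) (mul_pos (hp0 x) (hf0 x)).ne',
        Real.log_div h2δ.ne' hM0.ne', Real.log_mul (hp0 x).ne' (hf0 x).ne']
    rw [hp, gp_log hv, gp_log hv] at hl
    have hls := Real.log_le_sub_one_of_pos (hS0 x)
    have hTu : T x = x + u x := by simp [hu]
    rw [hTu] at hl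
    have hf := hf0 x
    have key : Real.log (f x) ≤ (S x - 1) - x * u x / v - u x ^ 2 / (2 * v)
        + (Real.log M - Real.log (1 - 2 * δ)) := by
      have : (x + u x) ^ 2 / (2 * v) = x ^ 2 / (2 * v) + x * u x / v + u x ^ 2 / (2 * (v:ℝ)) := by
        field_simp; ring
      linarith
    have key2 : 0 ≤ f' x * u x + v / 2 * (f' x ^ 2 / f x) + f x * (u x ^ 2 / (2 * v)) := by
      have : f' x * u x + v / 2 * (f' x ^ 2 / f x) + f x * (u x ^ 2 / (2 * v)) =
        (v * f' x + f x * u x) ^ 2 / (2 * v * f x) := by field_simp; ring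
      rw [this]; positivity
    have key3 := mul_le_mul_of_nonneg_left key hf.le
    have key4 : f x * Real.log (f x) ≤ (f' x * u x - x * f x * u x / v + f x * (S x - 1)) +
      (v / 2 * (f' x ^ 2 / f x)) + f x * (Real.log M - Real.log (1 - 2 * δ)) := by
      have : f x * (x * u x / v) = x * f x * u x / v := by ring
      linarith
    have := mul_le_mul_of_nonneg_left key4 (hp0 x).le
    linarith
  calc _ ≤ ∫ x, (p x * (f' x * u x - x * f x * u x / v + f x * (S x - 1)) +
      p x * (v / 2 * (f' x ^ 2 / f x)) + p x * f x * (Real.log M - Real.log (1 - 2 * δ))) :=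
        integral_mono hlogi ((hH'i.add hIi).add (hfi.mul_const _)) hpt
    _ = _ := by
      have i1 := integral_add hH'i hIi
      have i2 := integral_add (hH'i.add hIi) (hfi.mul_const (Real.log M - Real.log (1 - 2 * δ)))
      simp only [Pi.add_apply] at i1 i2
      rw [i2, i1, hzero, zero_add, integral_mul_const]

lemma lsi_one {v : ℝ≥0} (hv : v ≠ 0) {f f' : ℝ → ℝ} (hf : ∀ x, HasDerivAt f (f' x) x)
    (hf'c : Continuous f') {c C : ℝ} (hc : 0 < c) (hcf : ∀ x, c ≤ f x) (hfC : ∀ x, f x ≤ C)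
    (hf'C : ∀ x, |f' x| ≤ C) :
    (∫ x, f x * Real.log (f x) ∂gaussianReal 0 v) - (∫ x, f x ∂gaussianReal 0 v) *
      Real.log (∫ x, f x ∂gaussianReal 0 v) ≤ v / 2 * ∫ x, f' x ^ 2 / f x ∂gaussianReal 0 v := by
  simp only [integral_gaussianReal_eq_integral_smul hv, smul_eq_mul]
  have ht : Tendsto (fun δ : ℝ => (∫ x, gaussianPDFReal 0 v x * (v / 2 * (f' x ^ 2 / f x))) +
      (∫ x, gaussianPDFReal 0 v x * f x) *
        (Real.log (∫ x, gaussianPDFReal 0 v x * f x) - Real.log (1 - 2 * δ))) (𝓝[>] 0)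
      (𝓝 ((∫ x, gaussianPDFReal 0 v x * (v / 2 * (f' x ^ 2 / f x))) +
      (∫ x, gaussianPDFReal 0 v x * f x) *
        (Real.log (∫ x, gaussianPDFReal 0 v x * f x) - Real.log (1 - 2 * 0)))) := by
    apply tendsto_nhdsWithin_of_tendsto_nhds
    have : ContinuousAt (fun δ : ℝ => Real.log (1 - 2 * δ)) 0 :=
      ContinuousAt.log (by fun_prop) (by norm_num)
    exact ((tendsto_const_nhds.sub this.tendsto).const_mul _).const_add _
  have := ge_of_tendsto (b := ∫ x, gaussianPDFReal 0 v x * (f x * Real.log (f x))) ht (by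
    filter_upwards [Ioo_mem_nhdsGT (show (0:ℝ) < 1 / 2 by norm_num)] with δ hδ
    exact lsi_one_defect hv hf hf'c hc hcf hfC hf'C hδ.1 hδ.2)
  rw [← integral_const_mul]
  simp only [mul_zero, sub_zero, Real.log_one] at this
  have h2 : ∀ x, gaussianPDFReal 0 v x * (v / 2 * (f' x ^ 2 / f x)) =
    v / 2 * (gaussianPDFReal 0 v x * (f' x ^ 2 / f x)) := fun x => by ring
  simp only [h2] at this
  linarith

/-- Entropy. -/
noncomputable def gEnt {X : Type*} [MeasurableSpace X] (μ : Measure X) (f : X → ℝ) : ℝ :=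
  (∫ x, f x * Real.log (f x) ∂μ) - (∫ x, f x ∂μ) * Real.log (∫ x, f x ∂μ)

lemma integrable_bdd {X : Type*} [MeasurableSpace X] (μ : Measure X) [IsProbabilityMeasure μ]
    {f : X → ℝ} (hf : Measurable f) (C : ℝ) (h : ∀ x, |f x| ≤ C) : Integrable f μ :=
  Integrable.of_bound hf.aestronglyMeasurable C (Eventually.of_forall h)

lemma abs_log_le_of_mem {c C a : ℝ} (hc : 0 < c) (h1 : c ≤ a) (h2 : a ≤ C) :
    |Real.log a| ≤ |Real.log c| + |Real.log C| :=
  (abs_le_max_abs_abs (Real.log_le_log hc h1) (Real.log_le_log (hc.trans_le h1) h2)).trans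
        (max_le_add_of_nonneg (abs_nonneg _) (abs_nonneg _))

lemma abs_mul_log_le_of_mem {c C a b : ℝ} (hc : 0 < c) (h1 : c ≤ a) (h2 : a ≤ C)
    (h3 : c ≤ b) (h4 : b ≤ C) :
    |b * Real.log a| ≤ C * (|Real.log c| + |Real.log C|) := by
  rw [abs_mul, abs_of_pos (hc.trans_le h3)]
  have := abs_log_le_of_mem hc h1 h2
  have := hc.trans_le h3
  gcongr
  linarith

lemma integral_mem_of_mem {X : Type*} [MeasurableSpace X] (μ : Measure X) [IsProbabilityMeasure μ]
    {f : X → ℝ} (hf : Integrable f μ) {c C : ℝ} (hc : ∀ x, c ≤ f x) (hC : ∀ x, f x ≤ C) :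
    c ≤ ∫ x, f x ∂μ ∧ ∫ x, f x ∂μ ≤ C := by
  constructor
  · simpa using integral_mono (integrable_const c) hf hc
  · simpa using integral_mono hf (integrable_const C) hC

lemma gEnt_prod {X Y : Type*} [MeasurableSpace X] [MeasurableSpace Y] (μ : Measure X)
    (ν : Measure Y) [IsProbabilityMeasure μ] [IsProbabilityMeasure ν] {f : X × Y → ℝ}
    (hf : Measurable f) {c C : ℝ} (hc : 0 < c) (hcf : ∀ z, c ≤ f z) (hfC : ∀ z, f z ≤ C)
    {D₁ D₂ : X × Y → ℝ} (hD₁ : Integrable D₁ (μ.prod ν)) (hD₂ : Integrable D₂ (μ.prod ν))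
    (h₁ : ∀ y, gEnt μ (fun x => f (x, y)) ≤ ∫ x, D₁ (x, y) ∂μ)
    (h₂ : ∀ x, gEnt ν (fun y => f (x, y)) ≤ ∫ y, D₂ (x, y) ∂ν) :
    gEnt (μ.prod ν) f ≤ ∫ z, D₁ z + D₂ z ∂(μ.prod ν) := by
  have hC0 : 0 < C := by
    have : Nonempty (X × Y) := (μ.prod ν).nonempty_of_neZero
    obtain ⟨z⟩ := this
    exact hc.trans_le ((hcf z).trans (hfC z))
  set F : X → ℝ := fun x => ∫ y, f (x, y) ∂ν with hF
  set A : Y → ℝ := fun y => ∫ x, f (x, y) ∂μ with hA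
  have hf0 : ∀ z, 0 < f z := fun z => hc.trans_le (hcf z)
  have hfi : Integrable f (μ.prod ν) := integrable_bdd _ hf C fun z => by
    rw [abs_of_pos (hf0 z)]; exact hfC z
  have hFm : Measurable F := (StronglyMeasurable.integral_prod_right' (ν := ν) hf.stronglyMeasurable).measurable
  have hAm : Measurable A := (StronglyMeasurable.integral_prod_left' (μ := μ) hf.stronglyMeasurable).measurable
  have hfy : ∀ y, Integrable (fun x => f (x, y)) μ := fun y =>
    integrable_bdd _ (by fun_prop) C fun x => by rw [abs_of_pos (hf0 _)]; exact hfC _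
  have hfx : ∀ x, Integrable (fun y => f (x, y)) ν := fun x =>
    integrable_bdd _ (by fun_prop) C fun x => by rw [abs_of_pos (hf0 _)]; exact hfC _
  have hFb : ∀ x, c ≤ F x ∧ F x ≤ C := fun x =>
    integral_mem_of_mem ν (hfx x) (fun y => hcf _) (fun y => hfC _)
  have hAb : ∀ y, c ≤ A y ∧ A y ≤ C := fun y =>
    integral_mem_of_mem μ (hfy y) (fun y => hcf _) (fun y => hfC _)
  set N := ∫ z, f z ∂(μ.prod ν) with hN
  have hNb : c ≤ N ∧ N ≤ C := integral_mem_of_mem _ hfi hcf hfC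
  have hN0 : 0 < N := hc.trans_le hNb.1
  have hNF : ∫ x, F x ∂μ = N := (integral_prod _ hfi).symm
  have hNA : ∫ y, A y ∂ν = N := (integral_prod_symm _ hfi).symm
  have hflf : Integrable (fun z => f z * Real.log (f z)) (μ.prod ν) :=
    integrable_bdd _ (by fun_prop) _ fun z =>
      abs_mul_log_le_of_mem hc (hcf z) (hfC z) (hcf z) (hfC z)
  have hflF : Integrable (fun z : X × Y => f z * Real.log (F z.1)) (μ.prod ν) :=
    integrable_bdd _ (by fun_prop) _ fun z =>
      abs_mul_log_le_of_mem hc (hFb z.1).1 (hFb z.1).2 (hcf z) (hfC z)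
  have hflA : Integrable (fun z : X × Y => f z * Real.log (A z.2)) (μ.prod ν) :=
    integrable_bdd _ (by fun_prop) _ fun z =>
      abs_mul_log_le_of_mem hc (hAb z.2).1 (hAb z.2).2 (hcf z) (hfC z)
  have hFlF : Integrable (fun x => F x * Real.log (F x)) μ :=
    integrable_bdd _ (by fun_prop) _ fun z =>
      abs_mul_log_le_of_mem hc (hFb z).1 (hFb z).2 (hFb z).1 (hFb z).2
  have hAlA : Integrable (fun x => A x * Real.log (A x)) ν :=
    integrable_bdd _ (by fun_prop) _ fun z =>
      abs_mul_log_le_of_mem hc (hAb z).1 (hAb z).2 (hAb z).1 (hAb z).2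
  have hFi : Integrable F μ := hfi.integral_prod_left
  have hAi : Integrable A ν := hfi.integral_prod_right
  have hFA : Integrable (fun z : X × Y => F z.1 * A z.2) (μ.prod ν) := hFi.mul_prod hAi
  have e1 : ∫ z, f z * Real.log (F z.1) ∂(μ.prod ν) = ∫ x, F x * Real.log (F x) ∂μ := by
    rw [integral_prod _ hflF]
    congr 1; ext x
    simp only [integral_mul_const, hF]
  have e2 : ∫ z, f z * Real.log (A z.2) ∂(μ.prod ν) = ∫ y, A y * Real.log (A y) ∂ν := by
    rw [integral_prod_symm _ hflA]
    congr 1; ext x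
    simp only [integral_mul_const, hA]
  have e3 : ∫ z : X × Y, F z.1 * A z.2 ∂(μ.prod ν) = N * N := by
    rw [integral_prod_mul, hNF, hNA]
  have hpt : ∀ z : X × Y, f z * Real.log (A z.2) + f z * Real.log (F z.1) + f z - F z.1 * A z.2 / N
      ≤ f z * Real.log (f z) + f z * Real.log N := by
    intro z
    have a0 := hf0 z
    have b0 := hc.trans_le (hFb z.1).1
    have c0 := hc.trans_le (hAb z.2).1
    have := Real.log_le_sub_one_of_pos (x := F z.1 * A z.2 / (N * f z)) (by positivity)
    rw [Real.log_div (by positivity) (by positivity), Real.log_mul b0.ne' c0.ne',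
      Real.log_mul hN0.ne' a0.ne'] at this
    have h := mul_le_mul_of_nonneg_left this a0.le
    have h2 : f z * (F z.1 * A z.2 / (N * f z) - 1) = F z.1 * A z.2 / N - f z := by
      field_simp
    linarith
  have hineq := integral_mono (((hflA.add hflF).add hfi).sub (hFA.div_const N))
    (hflf.add (hfi.mul_const (Real.log N))) hpt
  simp only [Pi.add_apply, Pi.sub_apply] at hineq
  rw [integral_sub (f := fun z : X × Y => f z * Real.log (A z.2) + f z * Real.log (F z.1) + f z)
      ((hflA.add hflF).add hfi) (hFA.div_const N),
    integral_add (f := fun z : X × Y => f z * Real.log (A z.2) + f z * Real.log (F z.1))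
      (hflA.add hflF) hfi, integral_add hflA hflF,
    integral_add hflf (hfi.mul_const _), integral_div, integral_mul_const, e1, e2, e3,
    ← hN, mul_div_assoc, div_self hN0.ne', mul_one] at hineq
  have g1 := integral_mono (μ := ν) (hflf.integral_prod_right.sub hAlA) hD₁.integral_prod_right h₁
  have g2 := integral_mono (μ := μ) (hflf.integral_prod_left.sub hFlF) hD₂.integral_prod_left h₂
  simp only [Pi.sub_apply] at g1 g2
  rw [integral_sub hflf.integral_prod_right hAlA, ← integral_prod_symm _ hD₁,
    ← integral_prod_symm _ hflf] at g1
  rw [integral_sub hflf.integral_prod_left hFlF, ← integral_prod _ hD₂,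
    ← integral_prod _ hflf] at g2
  rw [integral_add hD₁ hD₂, gEnt]
  linarith

/-- product Gaussian -/
noncomputable abbrev gPi (v : ℝ≥0) (n : ℕ) : Measure (Fin n → ℝ) :=
  Measure.pi (fun _ => gaussianReal 0 v)

lemma hasFDerivAt_cons_right {n : ℕ} (a : ℝ) (y : Fin n → ℝ) :
    HasFDerivAt (fun y : Fin n → ℝ => (Fin.cons a y : Fin (n + 1) → ℝ))
      (ContinuousLinearMap.pi (Fin.cons 0 (fun i => ContinuousLinearMap.proj i) :
        Fin (n + 1) → ((Fin n → ℝ) →L[ℝ] ℝ))) y := by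
  rw [hasFDerivAt_pi]
  intro i
  refine Fin.cases ?_ (fun j => ?_) i
  · simpa using hasFDerivAt_const a y
  · simpa using (hasFDerivAt_apply j y)

lemma hasDerivAt_cons_left {n : ℕ} (a : ℝ) (y : Fin n → ℝ) :
    HasDerivAt (fun a : ℝ => (Fin.cons a y : Fin (n + 1) → ℝ)) (Pi.single 0 1) a := by
  rw [hasDerivAt_pi]
  intro i
  refine Fin.cases ?_ (fun j => ?_) i
  · simpa using hasDerivAt_id' a
  · simpa using (hasDerivAt_const a (y j))

lemma lsi_pi {v : ℝ≥0} (hv : v ≠ 0) (n : ℕ) : ∀ (f : (Fin n → ℝ) → ℝ) (_ : ContDiff ℝ 1 f)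
    (c C : ℝ) (_ : 0 < c) (_ : ∀ x, c ≤ f x) (_ : ∀ x, f x ≤ C)
    (_ : ∀ x i, |fderiv ℝ f x (Pi.single i 1)| ≤ C),
    gEnt (gPi v n) f ≤ ∫ x, v / 2 * ((∑ i, fderiv ℝ f x (Pi.single i 1) ^ 2) / f x) ∂(gPi v n) := by
  induction n with
  | zero =>
    intro f _ c C _ _ _ _
    simp only [gEnt, gPi, Measure.pi_of_empty _ (0 : Fin 0 → ℝ)]
    simp
  | succ n ih =>
    intro f hf c C hc hcf hfC hf'
    have hfd : Differentiable ℝ f := hf.differentiable (by norm_num)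
    have hf0 : ∀ z, 0 < f z := fun z => hc.trans_le (hcf z)
    let e := MeasurableEquiv.piFinSuccAbove (fun _ : Fin (n + 1) => ℝ) 0
    have he : MeasurePreserving e.symm ((gaussianReal 0 v).prod (gPi v n)) (gPi v (n + 1)) :=
      (measurePreserving_piFinSuccAbove (fun _ : Fin (n + 1) => gaussianReal 0 v) 0).symm
    have hes : ∀ z, e.symm z = Fin.cons z.1 z.2 := by
      intro z; simp [e, MeasurableEquiv.piFinSuccAbove, Fin.insertNthEquiv]
    have hchange : ∀ h : (Fin (n + 1) → ℝ) → ℝ, ∫ x, h x ∂(gPi v (n + 1)) =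
        ∫ z, h (Fin.cons z.1 z.2) ∂((gaussianReal 0 v).prod (gPi v n)) := by
      intro h
      rw [← he.integral_comp']
      simp only [hes]
    have hcm : Measurable (fun z : ℝ × (Fin n → ℝ) => (Fin.cons z.1 z.2 : Fin (n + 1) → ℝ)) := by
      have := e.symm.measurable
      rwa [show (e.symm : ℝ × (Fin n → ℝ) → (Fin (n + 1) → ℝ)) = fun z => Fin.cons z.1 z.2
        from funext hes] at this
    have hdc : ∀ i, Continuous fun x => fderiv ℝ f x (Pi.single i 1) := fun i =>
      (hf.continuous_fderiv (by norm_num)).clm_apply continuous_const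
    have hent : gEnt (gPi v (n + 1)) f =
        gEnt ((gaussianReal 0 v).prod (gPi v n)) (fun z => f (Fin.cons z.1 z.2)) := by
      simp only [gEnt]
      rw [hchange f, hchange (fun x => f x * Real.log (f x))]
    rw [hent, hchange]
    have hb : ∀ x i, |v / 2 * (fderiv ℝ f x (Pi.single i 1) ^ 2 / f x)| ≤ v / 2 * (C ^ 2 / c) := by
      intro x i
      rw [abs_of_nonneg (by have := hf0 x; positivity), ← sq_abs]
      have := hf' x i
      have := hcf x
      gcongr
    have hm : ∀ i, Measurable (fun x => v / 2 * (fderiv ℝ f x (Pi.single i 1) ^ 2 / f x)) := by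
      intro i
      have := (hdc i).measurable
      have := hf.continuous.measurable
      fun_prop
    refine (gEnt_prod (c := c) (C := C) (gaussianReal 0 v) (gPi v n) (f := fun z => f (Fin.cons z.1 z.2))
      (hf.continuous.measurable.comp hcm) hc (fun z => hcf _) (fun z => hfC _)
      (D₁ := fun z => v / 2 * (fderiv ℝ f (Fin.cons z.1 z.2) (Pi.single 0 1) ^ 2
        / f (Fin.cons z.1 z.2)))
      (D₂ := fun z => v / 2 * ((∑ i : Fin n, fderiv ℝ f (Fin.cons z.1 z.2) (Pi.single i.succ 1) ^ 2)
        / f (Fin.cons z.1 z.2))) ?_ ?_ ?_ ?_).trans (le_of_eq ?_)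
    · exact integrable_bdd _ ((hm 0).comp hcm) _ (fun z => hb _ _)
    · simp only [Finset.sum_div, Finset.mul_sum]
      exact integrable_finsetSum _ fun i _ =>
        integrable_bdd _ ((hm i.succ).comp hcm) _ (fun z => hb _ _)
    · intro y
      rw [integral_const_mul]
      refine lsi_one hv (f := fun x => f (Fin.cons x y))
        (f' := fun x => fderiv ℝ f (Fin.cons x y) (Pi.single 0 1)) (fun x => ?_) ?_ hc
        (fun x => hcf _) (fun x => hfC _) (fun x => hf' _ _)
      · exact (hfd _).hasFDerivAt.comp_hasDerivAt x (hasDerivAt_cons_left x y)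
      · exact (hdc 0).comp (continuous_iff_continuousAt.2 fun x =>
          (hasDerivAt_cons_left x y).continuousAt)
    · intro x
      have hfdx : ∀ y i, fderiv ℝ (fun y : Fin n → ℝ => f (Fin.cons x y)) y (Pi.single i 1) =
          fderiv ℝ f (Fin.cons x y) (Pi.single i.succ 1) := by
        intro y i
        have := ((hfd (Fin.cons x y)).hasFDerivAt.comp y (hasFDerivAt_cons_right x y)).fderiv
        rw [show (fun y : Fin n → ℝ => f (Fin.cons x y)) = f ∘ fun y : Fin n → ℝ => Fin.cons x y from rfl,
          this, ContinuousLinearMap.comp_apply]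
        congr 1
        ext j
        refine Fin.cases ?_ (fun k => ?_) j
        · simp
        · simp [Pi.single_apply]
      have := ih (fun y => f (Fin.cons x y)) (hf.comp (by
          rw [contDiff_pi]
          intro i
          refine Fin.cases ?_ (fun j => ?_) i
          · simpa using contDiff_const
          · simpa using contDiff_apply ℝ ℝ j)) c C hc (fun y => hcf _) (fun y => hfC _)
          (fun y i => by rw [hfdx]; exact hf' _ _)
      simpa only [hfdx] using this
    · congr 1; ext z
      rw [Fin.sum_univ_succ]
      ring

/-- product Gaussian density -/
noncomputable def gW (v : ℝ≥0) {n : ℕ} (x : Fin n → ℝ) : ℝ := ∏ i, gaussianPDFReal 0 v (x i)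

lemma gW_pos {v : ℝ≥0} (hv : v ≠ 0) {n : ℕ} (x : Fin n → ℝ) : 0 < gW v x :=
  Finset.prod_pos fun _ _ => gaussianPDFReal_pos 0 v _ hv

lemma gW_cont (v : ℝ≥0) (n : ℕ) : Continuous (gW v : (Fin n → ℝ) → ℝ) := by
  unfold gW
  have := continuous_gp v
  fun_prop

lemma gPi_eq {v : ℝ≥0} (hv : v ≠ 0) (n : ℕ) :
    gPi v n = volume.withDensity (fun x => ENNReal.ofReal (gW v x)) := by
  refine Measure.pi_eq fun s hs => ?_
  have hp0 : ∀ x, 0 ≤ gaussianPDFReal 0 v x := gaussianPDFReal_nonneg 0 v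
  have hi : Integrable (gW v : (Fin n → ℝ) → ℝ) :=
    Integrable.fintype_prod (fun _ => integrable_gaussianPDFReal 0 v)
  rw [withDensity_apply _ (MeasurableSet.univ_pi hs),
    ← ofReal_integral_eq_lintegral_ofReal hi.integrableOn
      (Eventually.of_forall fun x => (gW_pos hv x).le)]
  simp only [gaussianReal_apply_eq_integral 0 hv]
  rw [← ENNReal.ofReal_prod_of_nonneg fun i _ => integral_nonneg hp0]
  congr 1
  rw [← integral_indicator (MeasurableSet.univ_pi hs)]
  simp only [← integral_indicator (hs _)]
  rw [← integral_fintype_prod_volume_eq_prod]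
  congr 1; ext x
  by_cases hx : x ∈ univ.pi s
  · rw [indicator_of_mem hx, gW]
    refine Finset.prod_congr rfl fun i _ => ?_
    rw [indicator_of_mem (hx i (mem_univ i))]
  · rw [indicator_of_notMem hx]
    simp only [mem_univ_pi, not_forall] at hx
    obtain ⟨i, hi⟩ := hx
    exact (Finset.prod_eq_zero (Finset.mem_univ i) (indicator_of_notMem hi _)).symm

lemma integral_gPi {v : ℝ≥0} (hv : v ≠ 0) (n : ℕ) (h : (Fin n → ℝ) → ℝ) :
    ∫ x, h x ∂(gPi v n) = ∫ x, gW v x * h x := by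
  rw [gPi_eq hv, integral_withDensity_eq_integral_toReal_smul
    (gW_cont v n).measurable.ennreal_ofReal (Eventually.of_forall fun x => ENNReal.ofReal_lt_top)]
  congr 1; ext x
  rw [ENNReal.toReal_ofReal (gW_pos hv x).le, smul_eq_mul]

lemma gW_log {v : ℝ≥0} (hv : v ≠ 0) {n : ℕ} (x : Fin n → ℝ) :
    Real.log (gW v x) = -(n / 2) * Real.log (2 * π * v) - (∑ i, x i ^ 2) / (2 * v) := by
  rw [gW, Real.log_prod fun i _ => (gaussianPDFReal_pos 0 v _ hv).ne']
  simp only [gp_log hv, Finset.sum_sub_distrib, Finset.sum_div]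
  simp
  ring

lemma gW_eq {v : ℝ≥0} (hv : v ≠ 0) {n : ℕ} (x : Fin n → ℝ) :
    (gW v x)⁻¹ = rexp ((n / 2) * Real.log (2 * π * v) + (∑ i, x i ^ 2) / (2 * v)) := by
  rw [← Real.exp_log (inv_pos.2 (gW_pos hv x)), Real.log_inv, gW_log hv]
  congr 1; ring

lemma gW_inv_contDiff {v : ℝ≥0} (hv : v ≠ 0) {n : ℕ} :
    ContDiff ℝ 1 (fun x : Fin n → ℝ => (gW v x)⁻¹) := by
  simp only [gW_eq hv]
  fun_prop

lemma gW_inv_fderiv {v : ℝ≥0} (hv : v ≠ 0) {n : ℕ} (x : Fin n → ℝ) (i : Fin n) :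
    fderiv ℝ (fun x : Fin n → ℝ => (gW v x)⁻¹) x (Pi.single i 1) = (gW v x)⁻¹ * (x i / v) := by
  have hv' : (0:ℝ) < v := by positivity
  have h1 : HasFDerivAt (fun x : Fin n → ℝ => ∑ i, x i ^ 2)
      (∑ i, (2 * x i) • (ContinuousLinearMap.proj i : (Fin n → ℝ) →L[ℝ] ℝ)) x := by
    refine HasFDerivAt.fun_sum fun j _ => ?_
    have := (hasFDerivAt_apply (𝕜 := ℝ) j x).pow 2
    refine this.congr_fderiv ?_
    ext; simp
  have h2 := ((h1.mul_const (2 * (v:ℝ))⁻¹).const_add ((n / 2) * Real.log (2 * π * v))).exp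
  simp only [← div_eq_mul_inv] at h2
  simp only [gW_eq hv]
  rw [h2.fderiv]
  simp [Pi.single_apply]
  field_simp

lemma ibp_one {n : ℕ} {ψ : (Fin n → ℝ) → ℝ} (hψ : ContDiff ℝ 1 ψ) (hs : HasCompactSupport ψ)
    (i : Fin n) :
    ∫ x, 2 * (ψ x * fderiv ℝ ψ x (Pi.single i 1)) * x i = - ∫ x, ψ x ^ 2 := by
  have hd : Differentiable ℝ ψ := hψ.differentiable (by norm_num)
  have hdc : Continuous fun x => fderiv ℝ ψ x (Pi.single i 1) :=
      (hψ.continuous_fderiv (by norm_num)).clm_apply continuous_const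
  have hψc := hψ.continuous
  have hf2 : ∀ x, fderiv ℝ (fun x => ψ x ^ 2) x (Pi.single i 1) =
      2 * (ψ x * fderiv ℝ ψ x (Pi.single i 1)) := by
    intro x
    rw [((hd x).hasFDerivAt.pow 2).fderiv]
    simp; ring
  have hp : ∀ x, fderiv ℝ (fun x : Fin n → ℝ => x i) x (Pi.single i 1) = 1 := by
    intro x
    rw [(hasFDerivAt_apply (𝕜 := ℝ) i x).fderiv]; simp
  have := integral_mul_fderiv_eq_neg_fderiv_mul_of_integrable (μ := (volume : Measure (Fin n → ℝ)))
    (f := fun x : Fin n → ℝ => x i)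
    (g := fun x => ψ x ^ 2) (v := Pi.single i 1) (𝕜 := ℝ)
    (by
      simp only [hp]
      refine Continuous.integrable_of_hasCompactSupport (by fun_prop) ?_
      exact hs.mono' (fun x hx => subset_closure (by intro h; simp [h] at hx)))
    (by
      simp only [hf2]
      refine Continuous.integrable_of_hasCompactSupport (by fun_prop) ?_
      exact hs.mono' (fun x hx => subset_closure (by intro h; simp [h] at hx)))
    (by
      refine Continuous.integrable_of_hasCompactSupport (by fun_prop) ?_
      exact hs.mono' (fun x hx => subset_closure (by intro h; simp [h] at hx)))
    (fun x _ => by fun_prop) (fun x _ => by fun_prop)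
  simp only [hp, hf2, one_mul] at this
  rw [← this]
  congr 1; ext x; ring

/-- Gaussian LSI for compactly supported functions. -/
lemma lsi_cpt {v : ℝ≥0} (hv : v ≠ 0) {n : ℕ} {ψ : (Fin n → ℝ) → ℝ} (hψ : ContDiff ℝ 1 ψ)
    (hs : HasCompactSupport ψ) (h1 : ∫ x, ψ x ^ 2 = 1) :
    ∫ x, gW v x * ((ψ x ^ 2 * (gW v x)⁻¹) * Real.log (ψ x ^ 2 * (gW v x)⁻¹)) ≤
      ∫ x, 2 * (v:ℝ) * ∑ i, (fderiv ℝ ψ x (Pi.single i 1) + ψ x * (x i / (2 * v))) ^ 2 := by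
  have hv' : (0:ℝ) < v := by positivity
  have hψc := hψ.continuous
  have hw0 : ∀ x : Fin n → ℝ, 0 < gW v x := gW_pos hv
  have hwc := gW_cont v n
  have hdψ : Differentiable ℝ ψ := hψ.differentiable (by norm_num)
  have hdc : ∀ i, Continuous fun x => fderiv ℝ ψ x (Pi.single i 1) := fun i =>
      (hψ.continuous_fderiv (by norm_num)).clm_apply continuous_const
  set f : (Fin n → ℝ) → ℝ := fun x => ψ x ^ 2 * (gW v x)⁻¹ with hfdef
  have hf : ContDiff ℝ 1 f := (hψ.pow 2).mul (gW_inv_contDiff hv)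
  have hfs : HasCompactSupport f :=
    hs.mono' (fun x hx => subset_closure (by intro h; simp [hfdef, h] at hx))
  have hf0 : ∀ x, 0 ≤ f x := fun x => mul_nonneg (sq_nonneg _) (inv_pos.2 (hw0 x)).le
  obtain ⟨C₀, hC₀⟩ := hfs.exists_bound_of_continuous hf.continuous
  obtain ⟨C₁, hC₁⟩ := (hfs.fderiv (𝕜 := ℝ)).exists_bound_of_continuous
    (hf.continuous_fderiv (by norm_num))
  have hC₀' : ∀ x, f x ≤ C₀ := fun x => (le_abs_self _).trans (hC₀ x)
  have hC₀n : 0 ≤ C₀ := (hf0 0).trans (hC₀' 0)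
  have hC₁n : 0 ≤ C₁ := (norm_nonneg _).trans (hC₁ 0)
  have hfder : ∀ x i, fderiv ℝ f x (Pi.single i 1) =
      2 * ψ x * (gW v x)⁻¹ * (fderiv ℝ ψ x (Pi.single i 1) + ψ x * (x i / (2 * v))) := by
    intro x i
    have hA := ((hdψ x).hasFDerivAt.pow 2).mul
      (((gW_inv_contDiff hv).differentiable (by norm_num)) x).hasFDerivAt
    have : fderiv ℝ f x = _ := hA.fderiv
    rw [this]
    simp [gW_inv_fderiv hv]
    field_simp
    ring
  set R := ∫ x, 2 * (v:ℝ) * ∑ i, (fderiv ℝ ψ x (Pi.single i 1) + ψ x * (x i / (2 * v))) ^ 2 with hR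
  have hRi : Integrable (fun x => 2 * (v:ℝ) * ∑ i, (fderiv ℝ ψ x (Pi.single i 1)
      + ψ x * (x i / (2 * v))) ^ 2) := by
    refine Continuous.integrable_of_hasCompactSupport (by fun_prop) ?_
    have : HasCompactSupport (fun x => (ψ x, fderiv ℝ ψ x)) := by
      have h2 := hs.fderiv (𝕜 := ℝ)
      refine HasCompactSupport.intro (hs.isCompact.union h2.isCompact) fun x hx => ?_
      simp only [mem_union, not_or] at hx
      simp [image_eq_zero_of_notMem_tsupport hx.1, image_eq_zero_of_notMem_tsupport hx.2]
    exact this.mono' (fun x hx => subset_closure (by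
      intro h; simp only [Prod.mk_eq_zero] at h; simp [h.1, h.2] at hx))
  have hfi : ∫ x, f x ∂(gPi v n) = 1 := by
    rw [integral_gPi hv, ← h1]
    congr 1; ext x
    have := hw0 x
    simp only [hfdef]; field_simp
  have hfint : Integrable f (gPi v n) := integrable_bdd _ hf.continuous.measurable C₀ hC₀
  have hε : ∀ ε : ℝ, 0 < ε → gEnt (gPi v n) (fun x => f x + ε) ≤ R := by
    intro ε hε
    have hfd : ∀ x, fderiv ℝ (fun x => f x + ε) x = fderiv ℝ f x := fun x => fderiv_add_const _
    have hlsi := lsi_pi hv n (fun x => f x + ε) (hf.add contDiff_const) ε (C₀ + ε + C₁) hε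
      (fun x => by linarith [hf0 x]) (fun x => by linarith [hC₀' x])
      (fun x i => by
        rw [hfd]
        have h2 := (fderiv ℝ f x).le_opNorm (Pi.single i 1)
        have h3 : ‖(Pi.single i 1 : Fin n → ℝ)‖ ≤ 1 := by
          have := Pi.norm_single (G := fun _ : Fin n => ℝ) (i := i) (1:ℝ)
          rw [this]; simp
        have h4 : ‖fderiv ℝ f x‖ * ‖(Pi.single i 1 : Fin n → ℝ)‖ ≤ C₁ * 1 := by
          gcongr; exact hC₁ x
        rw [Real.norm_eq_abs] at h2
        linarith)
    refine hlsi.trans ?_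
    rw [integral_gPi hv, hR]
    refine integral_mono_of_nonneg (Eventually.of_forall fun x => ?_) hRi
      (Eventually.of_forall fun x => ?_)
    · have := hw0 x
      have := hf0 x
      simp only [Pi.zero_apply]
      positivity
    · simp only [hfd, hfder, mul_pow, ← Finset.mul_sum]
      have hw := hw0 x
      have hfx := hf0 x
      set Q := ∑ i, (fderiv ℝ ψ x (Pi.single i 1) + ψ x * (x i / (2 * v))) ^ 2
      have hQ : 0 ≤ Q := Finset.sum_nonneg fun i _ => sq_nonneg _
      have : 2 ^ 2 * ψ x ^ 2 * (gW v x)⁻¹ ^ 2 * Q / (f x + ε) ≤ 4 * (gW v x)⁻¹ * Q := by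
        rw [div_le_iff₀ (by linarith)]
        have : 2 ^ 2 * ψ x ^ 2 * (gW v x)⁻¹ ^ 2 * Q = 4 * (gW v x)⁻¹ * Q * f x := by
          simp only [hfdef]; ring
        rw [this]
        gcongr
        linarith
      calc gW v x * (v / 2 * (2 ^ 2 * ψ x ^ 2 * (gW v x)⁻¹ ^ 2 * Q / (f x + ε)))
          ≤ gW v x * (v / 2 * (4 * (gW v x)⁻¹ * Q)) := by gcongr
        _ = 2 * v * Q := by field_simp; ring
  have ht : Tendsto (fun ε : ℝ => gEnt (gPi v n) (fun x => f x + ε)) (𝓝[>] 0)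
      (𝓝 ((∫ x, f x * Real.log (f x) ∂(gPi v n)) - 1 * Real.log 1)) := by
    have hi : ∀ ε : ℝ, ∫ x, f x + ε ∂(gPi v n) = 1 + ε := by
      intro ε
      rw [integral_add hfint (integrable_const _), hfi]; simp
    simp only [gEnt, hi]
    refine Tendsto.sub ?_ ?_
    · obtain ⟨K, hK⟩ := (isCompact_Icc (a := (0:ℝ)) (b := C₀ + 1)).exists_bound_of_continuousOn
        Real.continuous_mul_log.continuousOn
      refine tendsto_integral_filter_of_dominated_convergence (fun _ => K) ?_ ?_
        (integrable_const _) ?_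
      · refine Eventually.of_forall fun ε => ?_
        have := hf.continuous
        exact (Real.continuous_mul_log.comp (by fun_prop : Continuous fun x => f x + ε)).aestronglyMeasurable
      · filter_upwards [Ioo_mem_nhdsGT (show (0:ℝ) < 1 by norm_num)] with ε hε
        refine Eventually.of_forall fun x => hK _ ⟨?_, ?_⟩
        · linarith [hf0 x, hε.1]
        · linarith [hC₀' x, hε.2]
      · refine Eventually.of_forall fun x => ?_
        apply tendsto_nhdsWithin_of_tendsto_nhds
        have : Continuous (fun ε : ℝ => (f x + ε) * Real.log (f x + ε)) :=
          Real.continuous_mul_log.comp (by fun_prop : Continuous fun ε : ℝ => f x + ε)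
        simpa using this.tendsto 0
    · apply tendsto_nhdsWithin_of_tendsto_nhds
      have : Continuous (fun ε : ℝ => (1 + ε) * Real.log (1 + ε)) :=
          Real.continuous_mul_log.comp (by fun_prop : Continuous fun ε : ℝ => 1 + ε)
      simpa using this.tendsto 0
  have hfin := le_of_tendsto ht (by
    filter_upwards [self_mem_nhdsWithin] with ε hε' using hε ε hε')
  rw [integral_gPi hv] at hfin
  simpa using hfin

lemma lsi_pi_final {v : ℝ≥0} (hv : v ≠ 0) {n : ℕ} {ψ : (Fin n → ℝ) → ℝ} (hψ : ContDiff ℝ 1 ψ)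
    (hs : HasCompactSupport ψ) (h1 : ∫ x, ψ x ^ 2 = 1) :
    n + n / 2 * Real.log (2 * π * v) ≤ 2 * v * (∫ x, ∑ i, fderiv ℝ ψ x (Pi.single i 1) ^ 2) -
      2 * ∫ x, ψ x ^ 2 * Real.log (ψ x) := by
  have hv' : (0:ℝ) < v := by positivity
  have hψc := hψ.continuous
  have hdc : ∀ i, Continuous fun x => fderiv ℝ ψ x (Pi.single i 1) := fun i =>
      (hψ.continuous_fderiv (by norm_num)).clm_apply continuous_const
  have key := lsi_cpt hv hψ hs h1
  have i1 : Integrable (fun x => ψ x ^ 2 * Real.log (ψ x)) := by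
    refine Continuous.integrable_of_hasCompactSupport ?_ ?_
    · have : (fun x => ψ x ^ 2 * Real.log (ψ x)) = fun x => ψ x * (ψ x * Real.log (ψ x)) := by
        ext x; ring
      rw [this]
      exact hψc.mul (Real.continuous_mul_log.comp hψc)
    · exact hs.mono' (fun x hx => subset_closure (by intro h; simp [h] at hx))
  have i2 : Integrable (fun x => ψ x ^ 2) := by
    refine Continuous.integrable_of_hasCompactSupport (by fun_prop) ?_
    exact hs.mono' (fun x hx => subset_closure (by intro h; simp [h] at hx))
  have i3 : Integrable (fun x => ψ x ^ 2 * ((∑ i, x i ^ 2) / (2 * v))) := by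
    refine Continuous.integrable_of_hasCompactSupport (by fun_prop) ?_
    exact hs.mono' (fun x hx => subset_closure (by intro h; simp [h] at hx))
  have i4 : Integrable (fun x => ∑ i, fderiv ℝ ψ x (Pi.single i 1) ^ 2) := by
    refine Continuous.integrable_of_hasCompactSupport (by fun_prop) ?_
    exact (hs.fderiv (𝕜 := ℝ)).mono' (fun x hx => subset_closure (by intro h; simp [h] at hx))
  have i5 : ∀ i, Integrable (fun x => 2 * (ψ x * fderiv ℝ ψ x (Pi.single i 1)) * x i) := by
    intro i
    refine Continuous.integrable_of_hasCompactSupport (by fun_prop) ?_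
    exact hs.mono' (fun x hx => subset_closure (by intro h; simp [h] at hx))
  have eL : ∫ x, gW v x * ((ψ x ^ 2 * (gW v x)⁻¹) * Real.log (ψ x ^ 2 * (gW v x)⁻¹)) =
      2 * (∫ x, ψ x ^ 2 * Real.log (ψ x)) + n / 2 * Real.log (2 * π * v) +
        ∫ x, ψ x ^ 2 * ((∑ i, x i ^ 2) / (2 * v)) := by
    have j := integral_add ((i1.const_mul 2).add (i2.mul_const (n / 2 * Real.log (2 * π * v)))) i3
    have j' := integral_add (i1.const_mul 2) (i2.mul_const (n / 2 * Real.log (2 * π * v)))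
    simp only [Pi.add_apply] at j j'
    rw [j', integral_const_mul, integral_mul_const, h1, one_mul] at j
    rw [← j]
    congr 1; ext x
    have hw := gW_pos hv x
    by_cases h0 : ψ x = 0
    · simp [h0]
    · rw [Real.log_mul (by positivity) (by positivity), Real.log_inv, gW_log hv, Real.log_pow]
      push_cast
      field_simp
      ring
  have eR : ∫ x, 2 * (v:ℝ) * ∑ i, (fderiv ℝ ψ x (Pi.single i 1) + ψ x * (x i / (2 * v))) ^ 2 =
      2 * v * (∫ x, ∑ i, fderiv ℝ ψ x (Pi.single i 1) ^ 2) - n +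
        ∫ x, ψ x ^ 2 * ((∑ i, x i ^ 2) / (2 * v)) := by
    have k1 : ∫ x, ∑ i, 2 * (ψ x * fderiv ℝ ψ x (Pi.single i 1)) * x i = -(n:ℝ) := by
      rw [integral_finsetSum _ fun i _ => i5 i]
      simp only [ibp_one hψ hs, h1]
      simp
    have i6 := integrable_finsetSum (μ := volume) (Finset.univ : Finset (Fin n)) fun i _ => i5 i
    have j := integral_add ((i4.const_mul (2 * (v:ℝ))).add i6) i3
    have j' := integral_add (i4.const_mul (2 * (v:ℝ))) i6
    simp only [Pi.add_apply] at j j'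
    rw [j', integral_const_mul, k1, ← sub_eq_add_neg] at j
    rw [← j]
    congr 1; ext x
    simp only [Finset.mul_sum, Finset.sum_div, ← Finset.sum_add_distrib]
    refine Finset.sum_congr rfl fun i _ => ?_
    field_simp
    ring
  rw [eL, eR] at key
  linarith

lemma norm_sq_dual {m : ℕ} (L : EuclideanSpace ℝ (Fin m) →L[ℝ] ℝ) :
    ‖L‖ ^ 2 = ∑ i, L (EuclideanSpace.single i 1) ^ 2 := by
  rw [← (InnerProductSpace.toDual ℝ _).symm.norm_map L, EuclideanSpace.norm_sq_eq]
  refine Finset.sum_congr rfl fun i _ => ?_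
  rw [← InnerProductSpace.toDual_symm_apply (𝕜 := ℝ) (y := L), real_inner_comm]
  simp [EuclideanSpace.inner_single_left]

lemma lsi_euclid (m : ℕ) (τ : ℝ) (hτ : 0 < τ) (φ : EuclideanSpace ℝ (Fin m) → ℝ)
    (hφ : ContDiff ℝ (⊤ : ℕ∞) φ) (hs : HasCompactSupport φ) (h1 : (∫ x, (φ x) ^ 2) = 1) :
      (m : ℝ) + ((m : ℝ) / 2) * Real.log (4 * Real.pi * τ) ≤
        4 * τ * (∫ x, ‖fderiv ℝ φ x‖ ^ 2) -
          2 * (∫ x, (φ x) ^ 2 * Real.log (φ x)) := by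
  let v : ℝ≥0 := ⟨2 * τ, by positivity⟩
  have hvv : (v : ℝ) = 2 * τ := rfl
  have hv : v ≠ 0 := by
    intro h
    have : (v:ℝ) = 0 := by rw [h]; rfl
    linarith
  let e := (PiLp.continuousLinearEquiv 2 ℝ (fun _ : Fin m => ℝ)).symm
  have hev : ∀ y, e y = WithLp.toLp 2 y := fun y => rfl
  have hch : ∀ h : EuclideanSpace ℝ (Fin m) → ℝ, ∫ x, h x = ∫ y, h (e y) := by
    intro h
    rw [← (PiLp.volume_preserving_toLp (Fin m)).integral_comp
      (MeasurableEquiv.toLp 2 (Fin m → ℝ)).measurableEmbedding]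
    rfl
  have hφ1 : ContDiff ℝ 1 φ := hφ.of_le (by exact_mod_cast le_top)
  have hψ : ContDiff ℝ 1 (fun y => φ (e y)) := hφ1.comp e.contDiff
  have hψs : HasCompactSupport (fun y => φ (e y)) := hs.comp_homeomorph e.toHomeomorph
  have hd : ∀ y i, fderiv ℝ (fun y => φ (e y)) y (Pi.single i 1) =
      fderiv ℝ φ (e y) (EuclideanSpace.single i 1) := by
    intro y i
    have := ((hφ1.differentiable (by norm_num) (e y)).hasFDerivAt.comp y
      e.hasFDerivAt).fderiv
    rw [show (fun y => φ (e y)) = φ ∘ e from rfl, this]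
    rfl
  have := lsi_pi_final hv hψ hψs (by rw [← h1, hch])
  simp only [hd, ← norm_sq_dual] at this
  rw [hch (fun x => ‖fderiv ℝ φ x‖ ^ 2), hch (fun x => φ x ^ 2 * Real.log (φ x))]
  rw [hvv] at this
  rw [show 4 * π * τ = 2 * π * (2 * τ) by ring, show 4 * τ = 2 * (2 * τ) by ring]
  exact this

theorem stmt_3 (m : ℕ) (hm : 1 ≤ m) (τ : ℝ) (hτ : 0 < τ) :
    (∀ φ : EuclideanSpace ℝ (Fin m) → ℝ, ContDiff ℝ (⊤ : ℕ∞) φ → HasCompactSupport φ →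
      (∀ x, 0 ≤ φ x) → (∫ x, (φ x) ^ 2) = 1 →
      (m : ℝ) + ((m : ℝ) / 2) * Real.log (4 * Real.pi * τ) ≤
        4 * τ * (∫ x, ‖fderiv ℝ φ x‖ ^ 2) -
          2 * (∫ x, (φ x) ^ 2 * Real.log (φ x))) ∧
    0 ≤ muFun m Set.univ (fun _ => 0) τ := by
  refine ⟨fun φ hφ hs _ h1 => lsi_euclid m τ hτ φ hφ hs h1, ?_⟩
  refine Real.sInf_nonneg ?_
  rintro w ⟨φ, ⟨hφ, hs, -, -, h1⟩, rfl⟩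
  rw [setIntegral_univ] at h1
  have key := lsi_euclid m τ hτ φ hφ hs h1
  have hφc := hφ.continuous
  have i1 : Integrable (fun x => 2 * (φ x ^ 2 * Real.log (φ x))) := by
    refine Integrable.const_mul ?_ 2
    refine Continuous.integrable_of_hasCompactSupport ?_ ?_
    · have : (fun x => φ x ^ 2 * Real.log (φ x)) = fun x => φ x * (φ x * Real.log (φ x)) := by
        ext x; ring
      rw [this]
      exact hφc.mul (Real.continuous_mul_log.comp hφc)
    · exact hs.mono' (fun x hx => subset_closure (by intro h; simp [h] at hx))
  have i2 : Integrable (fun x => 4 * τ * ‖fderiv ℝ φ x‖ ^ 2) := by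
    refine Integrable.const_mul ?_ _
    have := hφ.continuous_fderiv (by simp)
    refine Continuous.integrable_of_hasCompactSupport (by fun_prop) ?_
    exact (hs.fderiv (𝕜 := ℝ)).mono' (fun x hx => subset_closure (by intro h; simp [h] at hx))
  have e : ∫ x, (τ * (0 * (φ x) ^ 2 + 4 * ‖fderiv ℝ φ x‖ ^ 2) - 2 * (φ x) ^ 2 * Real.log (φ x)) =
      4 * τ * (∫ x, ‖fderiv ℝ φ x‖ ^ 2) - 2 * (∫ x, (φ x) ^ 2 * Real.log (φ x)) := by
    rw [← integral_const_mul, ← integral_const_mul, ← integral_sub i2 i1]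
    congr 1; ext x; ring
  rw [Wfun, setIntegral_univ, e]
  linarith
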